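/- Fix a with 0 < a < 1, and let ν be the unique solution in (0, π/2) of the class IV(ii) equation tan ν = coth(ν·a); set σ = ν·tanh(ν·a). Then σ is strictly smaller than the eigenvalue value produced by every positive solution of each of the other seven determining equations: σ < μ·tanh μ for every μ > 0 with tan(μ·a) + tanh μ = 0 (class I(i)); σ < μ·tanh(μ·a) for every μ > 0 with tan μ + tanh(μ·a) = 0 (class I(ii)); σ < μ·coth μ for every μ > 0 with tan(μ·a) = tanh μ (class II(i)); σ < μ·coth(μ·a) for every μ > 0 with tan μ = tanh(μ·a) (class II(ii)); σ < μ·tanh μ for every μ > 0 with tan(μ·a) = coth μ (class III(i)); σ < μ·coth(μ·a) for every μ > 0 with tan μ + coth(μ·a) = 0 (class III(ii)); and σ < μ·coth μ for every μ > 0 with tan(μ·a) + coth μ = 0 (class IV(i)). -/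

import Mathlib

lemma aux_tanh_lt {x y : ℝ} (h : x < y) : Real.tanh x < Real.tanh y := by
  rw [Real.tanh_eq_sinh_div_cosh, Real.tanh_eq_sinh_div_cosh,
    div_lt_div_iff₀ (Real.cosh_pos x) (Real.cosh_pos y)]
  have h1 : 0 < Real.sinh (y - x) := Real.sinh_pos_iff.2 (by linarith)
  rw [Real.sinh_sub] at h1
  linarith

lemma aux_sinh_lt {x : ℝ} (h : 0 < x) : Real.sinh x < x * Real.cosh x := by
  have hm : StrictMonoOn (fun t : ℝ => t * Real.cosh t - Real.sinh t) (Set.Ici 0) := by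
    apply strictMonoOn_of_hasDerivWithinAt_pos (convex_Ici 0)
      (f' := fun t => t * Real.sinh t)
    · fun_prop
    · intro t _
      have := ((hasDerivAt_id t).mul (Real.hasDerivAt_cosh t)).sub (Real.hasDerivAt_sinh t)
      refine (this.congr_deriv ?_).hasDerivWithinAt
      simp
    · intro t ht
      simp at ht
      exact mul_pos ht (Real.sinh_pos_iff.2 ht)
  have := hm (Set.mem_Ici.2 le_rfl) (Set.mem_Ici.2 h.le) h
  simp at this
  linarith

lemma aux_coth {x : ℝ} (h : 0 < x) : 1 < x * (Real.cosh x / Real.sinh x) := by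
  rw [← mul_div_assoc, one_lt_div (Real.sinh_pos_iff.2 h)]
  exact aux_sinh_lt h

lemma aux_sin {d p : ℝ} (hd : 0 < d) (hdp : d < p) (hp : p < Real.pi) :
    d * Real.sin p < p * Real.sin d := by
  have hp0 : 0 < p := hd.trans hdp
  have m0 : (0 : ℝ) ∈ Set.Icc 0 Real.pi := ⟨le_rfl, Real.pi_pos.le⟩
  have mp : p ∈ Set.Icc 0 Real.pi := ⟨hp0.le, hp.le⟩
  have c1 : 0 < 1 - d / p := by rw [sub_pos, div_lt_one hp0]; exact hdp
  have c2 : 0 < d / p := by positivity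
  have h := strictConcaveOn_sin_Icc.2 m0 mp hp0.ne c1 c2 (by ring)
  simp only [smul_eq_mul, Real.sin_zero, mul_zero, zero_add, div_mul_cancel₀ _ hp0.ne'] at h
  rw [div_mul_eq_mul_div, div_lt_iff₀ hp0] at h
  linarith

lemma aux_tan {s n : ℝ} (hs : 0 < s) (hsn : s < n) (hn : n < Real.pi / 2) :
    n / Real.tan n < s / Real.tan s := by
  have h1 := aux_sin (d := n - s) (p := n + s) (by linarith) (by linarith) (by linarith)
  rw [Real.sin_add, Real.sin_sub] at h1
  have a1 := Real.sin_pos_of_pos_of_lt_pi hs (by linarith)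
  have a2 := Real.sin_pos_of_pos_of_lt_pi (hs.trans hsn) (by linarith)
  rw [Real.tan_eq_sin_div_cos, Real.tan_eq_sin_div_cos, div_div_eq_mul_div, div_div_eq_mul_div,
    div_lt_div_iff₀ a2 a1]
  nlinarith

theorem stmt_12 (a : ℝ) (ha : 0 < a) (ha' : a < 1)
    (ν : ℝ) (hν : ν ∈ Set.Ioo 0 (Real.pi / 2))
    (hνeq : Real.tan ν = Real.cosh (ν * a) / Real.sinh (ν * a))
    (σ : ℝ) (hσ : σ = ν * Real.tanh (ν * a)) :
    (∀ μ : ℝ, 0 < μ → Real.tan (μ * a) + Real.tanh μ = 0 → σ < μ * Real.tanh μ) ∧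
    (∀ μ : ℝ, 0 < μ → Real.tan μ + Real.tanh (μ * a) = 0 → σ < μ * Real.tanh (μ * a)) ∧
    (∀ μ : ℝ, 0 < μ → Real.tan (μ * a) = Real.tanh μ → σ < μ * (Real.cosh μ / Real.sinh μ)) ∧
    (∀ μ : ℝ, 0 < μ → Real.tan μ = Real.tanh (μ * a) →
      σ < μ * (Real.cosh (μ * a) / Real.sinh (μ * a))) ∧
    (∀ μ : ℝ, 0 < μ → Real.tan (μ * a) = Real.cosh μ / Real.sinh μ → σ < μ * Real.tanh μ) ∧
    (∀ μ : ℝ, 0 < μ → Real.tan μ + Real.cosh (μ * a) / Real.sinh (μ * a) = 0 →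
      σ < μ * (Real.cosh (μ * a) / Real.sinh (μ * a))) ∧
    (∀ μ : ℝ, 0 < μ → Real.tan (μ * a) + Real.cosh μ / Real.sinh μ = 0 →
      σ < μ * (Real.cosh μ / Real.sinh μ)) := by
  obtain ⟨hν0, hνp⟩ := hν
  have tpos : ∀ x : ℝ, 0 < x → 0 < Real.tanh x := fun x hx => by
    have := aux_tanh_lt hx
    rwa [Real.tanh_zero] at this
  have hσt : σ = ν / Real.tan ν := by
    rw [hσ, hνeq, Real.tanh_eq_sinh_div_cosh, div_div_eq_mul_div, mul_div_assoc]
  have hσ1 : σ < 1 := by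
    have := Real.lt_tan hν0 hνp
    rw [hσt, div_lt_one (hν0.trans this)]
    exact this
  have hsm : ∀ μ : ℝ, 0 < μ → μ * a < μ := fun μ h => by nlinarith
  have hgt2 : ∀ μ : ℝ, ν < μ → σ < μ * Real.tanh (μ * a) := fun μ h => by
    rw [hσ]
    have h1 := aux_tanh_lt (mul_lt_mul_of_pos_right h ha)
    have h2 := tpos _ (mul_pos hν0 ha)
    exact mul_lt_mul'' h h1 hν0.le h2.le
  have hge : ∀ μ : ℝ, ν ≤ μ → σ < μ * Real.tanh μ := fun μ h => by
    rw [hσ]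
    have h1 := aux_tanh_lt ((hsm ν hν0).trans_le h)
    have h2 := tpos _ (mul_pos hν0 ha)
    exact mul_lt_mul' h h1 h2.le (hν0.trans_le h)
  have hneg : ∀ x : ℝ, 0 < x → Real.tan x < 0 → ν < x := fun x hx h => by
    by_contra! hc
    have := Real.tan_pos_of_pos_of_lt_pi_div_two hx (by linarith)
    linarith
  have hc1 : ∀ μ : ℝ, 0 < μ → σ < μ * (Real.cosh μ / Real.sinh μ) := fun μ h =>
    hσ1.trans (aux_coth h)
  have hc2 : ∀ μ : ℝ, 0 < μ → σ < μ * (Real.cosh (μ * a) / Real.sinh (μ * a)) := fun μ h => by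
    have h0 := mul_pos h ha
    refine (hσ1.trans (aux_coth h0)).trans (mul_lt_mul_of_pos_right (hsm μ h) ?_)
    exact div_pos (Real.cosh_pos _) (Real.sinh_pos_iff.2 h0)
  refine ⟨fun μ h e => hge μ ?_, fun μ h e => hgt2 μ ?_, fun μ h _ => hc1 μ h, fun μ h _ => hc2 μ h,
    fun μ h e => ?_, fun μ h _ => hc2 μ h, fun μ h _ => hc1 μ h⟩
  · have := tpos μ h
    exact ((hneg _ (mul_pos h ha) (by linarith)).trans (hsm μ h)).le
  · have := tpos _ (mul_pos h ha)
    exact hneg μ h (by linarith)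
  · rcases le_or_gt ν μ with hc | hc
    · exact hge μ hc
    · have h0 := mul_pos h ha
      have h1 := aux_tan h0 ((hsm μ h).trans hc) hνp
      have h2 : μ * Real.tanh μ = μ / Real.tan (μ * a) := by
        rw [e, Real.tanh_eq_sinh_div_cosh, div_div_eq_mul_div, mul_div_assoc]
      rw [h2, hσt]
      refine h1.trans (div_lt_div_of_pos_right (hsm μ h) ?_)
      rw [e]
      exact div_pos (Real.cosh_pos _) (Real.sinh_pos_iff.2 h)
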